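/- arXiv:2412.10375 — 6 statements merged into one kernel-verified Lean document; each statement's English description precedes it below -/
import Mathlib

section
/- Let A = (a_{ij}) ∈ M_n(ℝ₊) be an n×n matrix with nonnegative real entries. Then the max numerical range of A equals the closed interval W_max(A) = [a, b] ⊆ ℝ₊, where a = min_{1≤i≤n} a_{ii} and b = max_{1≤i,j≤n} a_{ij}. -/
open Matrix

namespace MaxAlg

variable {I J K : Type*}

/-- Entrywise nonnegative matrix (matrix over `ℝ₊`). -/
def Nonneg (A : Matrix I J ℝ) : Prop := ∀ i j, 0 ≤ A i j

/-- Max-algebra matrix product: `(A ⊗ B) i k = max_j (A i j * B j k)`. -/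
noncomputable def maxMul [Fintype J] (A : Matrix I J ℝ) (B : Matrix J K ℝ) :
    Matrix I K ℝ :=
  Matrix.of fun i k => ⨆ j, A i j * B j k

/-- Max trace: `tr_⊗(M) = max_i M i i`. -/
noncomputable def maxTrace (M : Matrix I I ℝ) : ℝ := ⨆ i, M i i

/-- Max isometry: a nonnegative matrix `X` with `Xᵗ ⊗ X = I`. -/
def IsMaxIsometry [Fintype I] [Fintype J] [DecidableEq J] (X : Matrix I J ℝ) : Prop :=
  Nonneg X ∧ maxMul Xᵀ X = 1

/-- Max numerical range `W_max(A) = {xᵗ⊗A⊗x : x ∈ ℝ₊ⁿ, xᵗ⊗x = 1}`,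
vectors being treated as `n × 1` matrices. -/
noncomputable def WMax [Fintype I] (A : Matrix I I ℝ) : Set ℝ :=
  {r | ∃ x : Matrix I (Fin 1) ℝ, Nonneg x ∧ maxMul xᵀ x = 1 ∧
    r = maxMul xᵀ (maxMul A x) 0 0}

/-- Max rank-`k` numerical range
`Λ_k^max(A) = {λ ∈ ℝ₊ : Xᵗ⊗A⊗X = λ I_k for some max isometry X}`. -/
noncomputable def LambdaMax [Fintype I] (k : ℕ) (A : Matrix I I ℝ) : Set ℝ :=
  {lam | 0 ≤ lam ∧ ∃ X : Matrix I (Fin k) ℝ, IsMaxIsometry X ∧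
    maxMul Xᵀ (maxMul A X) = lam • (1 : Matrix (Fin k) (Fin k) ℝ)}

/-- Max `k`-numerical range `W_max^k(A) = {tr_⊗(Xᵗ⊗A⊗X) : X ∈ 𝒳_{n×k}}`. -/
noncomputable def WMaxK [Fintype I] (k : ℕ) (A : Matrix I I ℝ) : Set ℝ :=
  {r | ∃ X : Matrix I (Fin k) ℝ, IsMaxIsometry X ∧
    r = maxTrace (maxMul Xᵀ (maxMul A X))}

/-- Max joint `k`-numerical range of an `m`-tuple of matrices. -/
noncomputable def WMaxKJoint [Fintype I] {m : ℕ} (k : ℕ)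
    (A : Fin m → Matrix I I ℝ) : Set (Fin m → ℝ) :=
  {v | ∃ X : Matrix I (Fin k) ℝ, IsMaxIsometry X ∧
    ∀ l, v l = maxTrace (maxMul Xᵀ (maxMul (A l) X))}

/-- Sup-norm of a real matrix: maximum absolute value of an entry. -/
noncomputable def matNorm (M : Matrix I J ℝ) : ℝ := ⨆ i, ⨆ j, |M i j|

/-- Sup-norm of a real vector: maximum absolute value of an entry. -/
noncomputable def vecNorm (v : I → ℝ) : ℝ := ⨆ i, |v i|

/-- Entrywise maximum (`max sum`) of two matrices. -/
def maxAdd (A B : Matrix I J ℝ) : Matrix I J ℝ :=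
  Matrix.of fun i j => max (A i j) (B i j)

/-- Max joint `c`-numerical range of an `m`-tuple of matrices:
`{(max_i c_i (xᵢᵗ⊗A₁⊗xᵢ), …) : X = [x₁,…,xₙ] max unitary}`; note that
`xᵢᵗ⊗A⊗xᵢ` is the `(i,i)` entry of `Xᵗ⊗A⊗X`. -/
noncomputable def WMaxCJoint {n m : ℕ} (c : Fin n → ℝ)
    (A : Fin m → Matrix (Fin n) (Fin n) ℝ) : Set (Fin m → ℝ) :=
  {v | ∃ U : Matrix (Fin n) (Fin n) ℝ, IsMaxIsometry U ∧
    ∀ l, v l = ⨆ i, c i * maxMul Uᵀ (maxMul (A l) U) i i}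

/-- Max joint `C`-numerical range of an `m`-tuple of matrices:
`{(tr_⊗(C⊗Xᵗ⊗A₁⊗X), …) : X max unitary}`. -/
noncomputable def WMaxBigCJoint {n m : ℕ} (C : Matrix (Fin n) (Fin n) ℝ)
    (A : Fin m → Matrix (Fin n) (Fin n) ℝ) : Set (Fin m → ℝ) :=
  {v | ∃ X : Matrix (Fin n) (Fin n) ℝ, IsMaxIsometry X ∧
    ∀ l, v l = maxTrace (maxMul C (maxMul Xᵀ (maxMul (A l) X)))}

/-- A finite supremum of continuous real functions is continuous. -/
theorem continuous_iSup_of_finite {ι X : Type*} [Finite ι] [Nonempty ι] [TopologicalSpace X]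
    {f : ι → X → ℝ} (hf : ∀ i, Continuous (f i)) : Continuous fun x => ⨆ i, f i x := by
  have := Fintype.ofFinite ι
  simp_rw [← Finset.sup'_univ_eq_ciSup]
  exact Continuous.finset_sup'_apply _ fun i _ => hf i

theorem maxMul_transpose_self_eq_one_iff [Fintype I] (x : Matrix I (Fin 1) ℝ) :
    maxMul xᵀ x = 1 ↔ ⨆ i, x i 0 * x i 0 = 1 := by
  constructor
  · intro h
    simpa [maxMul] using congrFun (congrFun h 0) 0
  · intro h
    ext i j
    rw [Subsingleton.elim i 0, Subsingleton.elim j 0]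
    simpa [maxMul] using h

theorem maxMul_quadratic_apply [Fintype I] (A : Matrix I I ℝ) (x : Matrix I (Fin 1) ℝ) :
    maxMul xᵀ (maxMul A x) 0 0 = ⨆ i, x i 0 * ⨆ j, A i j * x j 0 :=
  rfl

theorem WMax_subset_Icc [Fintype I] [Nonempty I] {A : Matrix I I ℝ} (hA : Nonneg A) :
    WMax A ⊆ Set.Icc (⨅ i, A i i) (⨆ i, ⨆ j, A i j) := by
  have bdd (f : I → ℝ) : BddAbove (Set.range f) := (Set.finite_range f).bddAbove
  rintro r ⟨x, hx, hx1, rfl⟩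
  rw [maxMul_transpose_self_eq_one_iff] at hx1
  rw [maxMul_quadratic_apply]
  have hle (i : I) : x i 0 ≤ 1 := by
    have h : x i 0 * x i 0 ≤ 1 := hx1 ▸ le_ciSup (bdd fun i => x i 0 * x i 0) i
    nlinarith [hx i 0]
  obtain ⟨i, hi⟩ := exists_eq_ciSup_of_finite (f := fun i => x i 0 * x i 0)
  have hi1 : x i 0 = 1 := by
    have h : x i 0 * x i 0 = 1 := hi.trans hx1
    nlinarith [hx i 0]
  constructor
  · refine (ciInf_le (Set.finite_range fun i => A i i).bddBelow i).trans ?_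
    refine le_trans ?_ (le_ciSup (bdd fun i => x i 0 * ⨆ j, A i j * x j 0) i)
    simpa [hi1] using le_ciSup (bdd fun j => A i j * x j 0) i
  · refine ciSup_mono (bdd _) fun i => ?_
    have h : ⨆ j, A i j * x j 0 ≤ ⨆ j, A i j :=
      ciSup_mono (bdd _) fun j => mul_le_of_le_one_right (hA i j) (hle j)
    have h0 : 0 ≤ ⨆ j, A i j * x j 0 :=
      Real.iSup_nonneg fun j => mul_nonneg (hA i j) (hx j 0)
    exact (mul_le_of_le_one_left h0 (hle i)).trans h

theorem Icc_subset_WMax [Fintype I] [Nonempty I] {A : Matrix I I ℝ} (hA : Nonneg A) :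
    Set.Icc (⨅ i, A i i) (⨆ i, ⨆ j, A i j) ⊆ WMax A := by
  classical
  have bdd (f : I → ℝ) : BddAbove (Set.range f) := (Set.finite_range f).bddAbove
  obtain ⟨k, hk⟩ := exists_eq_ciInf_of_finite (f := fun i => A i i)
  let x (t : ℝ) (i : I) : ℝ := if i = k then 1 else t
  let f (t : ℝ) : ℝ := ⨆ i, x t i * ⨆ j, A i j * x t j
  have hx (i : I) : Continuous fun t => x t i := by
    by_cases h : i = k <;> simp only [x, h, if_true, if_false] <;> fun_prop
  have hf : Continuous f := continuous_iSup_of_finite fun i =>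
    (hx i).mul (continuous_iSup_of_finite fun j => continuous_const.mul (hx j))
  have hf0 : f 0 ≤ ⨅ i, A i i := by
    rw [← hk]
    refine ciSup_le fun i => ?_
    by_cases hi : i = k
    · subst hi
      simp only [x, if_true, one_mul]
      refine ciSup_le fun j => ?_
      by_cases hj : j = i
      · simp [hj]
      · simpa [hj] using hA i i
    · simpa [x, hi] using hA k k
  have hf1 : f 1 = ⨆ i, ⨆ j, A i j := by simp [f, x]
  rintro r ⟨hr0, hr1⟩
  obtain ⟨t, ⟨ht0, ht1⟩, rfl⟩ := intermediate_value_Icc zero_le_one hf.continuousOn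
    (show r ∈ Set.Icc (f 0) (f 1) from ⟨hf0.trans hr0, hf1 ▸ hr1⟩)
  have hx0 (i : I) : 0 ≤ x t i := by
    by_cases h : i = k <;> simp [x, h, ht0]
  have hxle (i : I) : x t i ≤ 1 := by
    by_cases h : i = k <;> simp [x, h, ht1]
  refine ⟨Matrix.of fun i _ => x t i, fun i _ => hx0 i, ?_, rfl⟩
  rw [maxMul_transpose_self_eq_one_iff]
  refine le_antisymm (ciSup_le fun i => mul_le_one₀ (hxle i) (hx0 i) (hxle i)) ?_
  simpa [x] using le_ciSup (bdd fun i => x t i * x t i) k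

/-- `W_max(A) = [min_i a_ii, max_{i,j} a_ij]`. -/
theorem wmax_eq_Icc {n : ℕ} (hn : 0 < n) (A : Matrix (Fin n) (Fin n) ℝ)
    (hA : Nonneg A) :
    WMax A = Set.Icc (⨅ i, A i i) (⨆ i, ⨆ j, A i j) := by
  have : Nonempty (Fin n) := ⟨⟨0, hn⟩⟩
  exact (WMax_subset_Icc hA).antisymm (Icc_subset_WMax hA)

end MaxAlg
end

section
/- Let B₁ ∈ M_{n₁}(ℝ₊), B₂ ∈ M_{n₂}(ℝ₊), and let A ∈ M_n(ℝ₊) be the block-diagonal matrix A = diag(B₁, B₂) with n = n₁ + n₂. For every 1 ≤ k₁ ≤ n₁ and 1 ≤ k₂ ≤ n₂, one has Λ_{k₁}^max(B₁) ∩ Λ_{k₂}^max(B₂) ⊆ Λ_{k₁+k₂}^max(A). -/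
open Matrix

namespace MaxAlg

variable {I J K : Type*}

section BlockDiagonal

variable {I₁ I₂ J₁ J₂ K₁ K₂ : Type*}

theorem Nonneg.maxMul [Fintype J] {A : Matrix I J ℝ} {B : Matrix J K ℝ}
    (hA : Nonneg A) (hB : Nonneg B) : Nonneg (maxMul A B) := fun i k =>
  Real.iSup_nonneg fun j => mul_nonneg (hA i j) (hB j k)

theorem Nonneg.transpose {A : Matrix I J ℝ} (hA : Nonneg A) : Nonneg Aᵀ := fun i j => hA j i

theorem Nonneg.fromBlocks_diagonal {A : Matrix I₁ J₁ ℝ} {B : Matrix I₂ J₂ ℝ}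
    (hA : Nonneg A) (hB : Nonneg B) : Nonneg (fromBlocks A 0 0 B) := by
  rintro (i | i) (j | j)
  exacts [hA i j, le_rfl, le_rfl, hB i j]

theorem iSup_sum_of_inr_eq_zero [Finite I] [Finite J] {f : I ⊕ J → ℝ}
    (hl : ∀ i, 0 ≤ f (.inl i)) (hr : ∀ j, f (.inr j) = 0) : ⨆ x, f x = ⨆ i, f (.inl i) := by
  have hbdd : BddAbove (Set.range fun i => f (.inl i)) := (Set.finite_range _).bddAbove
  apply le_antisymm
  · refine Real.iSup_le ?_ (Real.iSup_nonneg hl)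
    rintro (i | j)
    · exact le_ciSup hbdd i
    · exact (hr j).trans_le (Real.iSup_nonneg hl)
  · refine Real.iSup_le (fun i => le_ciSup (Set.finite_range f).bddAbove (.inl i))
      (Real.iSup_nonneg ?_)
    rintro (i | j)
    exacts [hl i, (hr j).ge]

theorem iSup_sum_of_inl_eq_zero [Finite I] [Finite J] {f : I ⊕ J → ℝ}
    (hl : ∀ i, f (.inl i) = 0) (hr : ∀ j, 0 ≤ f (.inr j)) : ⨆ x, f x = ⨆ j, f (.inr j) := by
  rw [← (Equiv.sumComm J I).iSup_comp]
  exact iSup_sum_of_inr_eq_zero (f := fun x => f (Equiv.sumComm J I x)) hr hl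

theorem maxMul_fromBlocks_diagonal [Fintype J₁] [Fintype J₂]
    {A : Matrix I₁ J₁ ℝ} {B : Matrix I₂ J₂ ℝ} {C : Matrix J₁ K₁ ℝ} {D : Matrix J₂ K₂ ℝ}
    (hA : Nonneg A) (hB : Nonneg B) (hC : Nonneg C) (hD : Nonneg D) :
    maxMul (fromBlocks A 0 0 B) (fromBlocks C 0 0 D) =
      fromBlocks (maxMul A C) 0 0 (maxMul B D) := by
  ext (i | i) (k | k)
  · exact iSup_sum_of_inr_eq_zero (fun j => mul_nonneg (hA i j) (hC j k)) (by simp)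
  · simp [maxMul, iSup_sum_of_inr_eq_zero]
  · simp [maxMul, iSup_sum_of_inr_eq_zero]
  · exact iSup_sum_of_inl_eq_zero (by simp) (fun j => mul_nonneg (hB i j) (hD j k))

theorem transpose_fromBlocks_diagonal (A : Matrix I₁ J₁ ℝ) (B : Matrix I₂ J₂ ℝ) :
    (fromBlocks A 0 0 B)ᵀ = fromBlocks Aᵀ 0 0 Bᵀ := by
  simp [fromBlocks_transpose]

end BlockDiagonal

/-- `Λ_{k₁}^max(B₁) ∩ Λ_{k₂}^max(B₂) ⊆ Λ_{k₁+k₂}^max(diag(B₁,B₂))`. -/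
theorem lambdaMax_inter_subset_blockDiag {n₁ n₂ : ℕ}
    (B₁ : Matrix (Fin n₁) (Fin n₁) ℝ) (B₂ : Matrix (Fin n₂) (Fin n₂) ℝ)
    (hB₁ : Nonneg B₁) (hB₂ : Nonneg B₂) {k₁ k₂ : ℕ}
    (hk₁ : 1 ≤ k₁) (hk₁n : k₁ ≤ n₁) (hk₂ : 1 ≤ k₂) (hk₂n : k₂ ≤ n₂) :
    LambdaMax k₁ B₁ ∩ LambdaMax k₂ B₂ ⊆
      LambdaMax (k₁ + k₂) (Matrix.fromBlocks B₁ 0 0 B₂) := by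
  rintro lam ⟨⟨hlam, X, ⟨hX, hXX⟩, hXB⟩, -, Y, ⟨hY, hYY⟩, hYB⟩
  let e := (finSumFinEquiv (m := k₁) (n := k₂)).symm
  let Z := fromBlocks X 0 0 Y
  have hZ : Nonneg Z := hX.fromBlocks_diagonal hY
  have hZZ : maxMul Zᵀ Z = 1 := by
    rw [transpose_fromBlocks_diagonal,
      maxMul_fromBlocks_diagonal hX.transpose hY.transpose hX hY, hXX, hYY, fromBlocks_one]
  have hZB : maxMul Zᵀ (maxMul (fromBlocks B₁ 0 0 B₂) Z) = lam • 1 := by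
    rw [transpose_fromBlocks_diagonal, maxMul_fromBlocks_diagonal hB₁ hB₂ hX hY,
      maxMul_fromBlocks_diagonal hX.transpose hY.transpose (hB₁.maxMul hX) (hB₂.maxMul hY),
      hXB, hYB, ← fromBlocks_one, fromBlocks_smul, smul_zero, smul_zero]
  refine ⟨hlam, Z.submatrix id e, ⟨fun i j => hZ i (e j), ?_⟩, ?_⟩
  · change (maxMul Zᵀ Z).submatrix e e = 1
    rw [hZZ, submatrix_one_equiv]
  · change (maxMul Zᵀ (maxMul (fromBlocks B₁ 0 0 B₂) Z)).submatrix e e = lam • 1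
    rw [hZB, submatrix_smul, Pi.smul_apply, Pi.smul_apply, submatrix_one_equiv]

end MaxAlg
end

section
/- Let A ∈ M_n(ℝ₊). Then Λ_n^max(A) ≠ ∅ if and only if A = λ I_n for some λ ∈ ℝ₊. -/
open Matrix

namespace MaxAlg

variable {I J K : Type*}

/-- The supremum of a finite nonnegative family supported at one index is its value there. -/
lemma iSup_eq_of_support_singleton {ι : Type*} [Finite ι] {f : ι → ℝ} (a : ι) (ha : 0 ≤ f a)
    (hf : ∀ i, i ≠ a → f i = 0) : ⨆ i, f i = f a := by
  have : Nonempty ι := ⟨a⟩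
  refine le_antisymm (ciSup_le fun i => ?_) (le_ciSup (Set.finite_range f).bddAbove a)
  rcases eq_or_ne i a with rfl | h
  · exact le_rfl
  · rw [hf i h]
    exact ha

/-- Max multiplication on the right by the matrix of `σ` permutes columns. -/
lemma maxMul_apply_of_perm [Fintype J] [DecidableEq J] {A : Matrix I J ℝ} (hA : Nonneg A)
    {X : Matrix J K ℝ} (σ : K → J) (hX : ∀ j k, X j k = if j = σ k then 1 else 0) (i : I) (k : K) :
    maxMul A X i k = A i (σ k) := by
  rw [maxMul, Matrix.of_apply, iSup_eq_of_support_singleton (σ k)]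
  · simp [hX]
  · simpa [hX] using hA i (σ k)
  · intro j hj
    simp [hX, hj]

/-- Max multiplication on the left by the transposed matrix of `σ` permutes rows. -/
lemma maxMul_transpose_apply_of_perm [Fintype I] [DecidableEq I] {A : Matrix I J ℝ}
    (hA : Nonneg A) {X : Matrix I K ℝ} (σ : K → I)
    (hX : ∀ i k, X i k = if i = σ k then 1 else 0) (k : K) (j : J) :
    maxMul Xᵀ A k j = A (σ k) j := by
  rw [maxMul, Matrix.of_apply, iSup_eq_of_support_singleton (σ k)]
  · simp [hX]
  · simpa [hX] using hA (σ k) j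
  · intro i hi
    simp [hX, hi]

/-- A square max isometry is a permutation matrix. -/
lemma IsMaxIsometry.exists_perm [Fintype I] [DecidableEq I] {X : Matrix I I ℝ}
    (hX : IsMaxIsometry X) :
    ∃ σ : Equiv.Perm I, ∀ i j, X i j = if i = σ j then 1 else 0 := by
  obtain ⟨hpos, hiso⟩ := hX
  have hentry : ∀ j k, ⨆ i, X i j * X i k = (1 : Matrix I I ℝ) j k := fun j k => by
    rw [← hiso]
    rfl
  have hone : ∀ j, ∃ i, X i j = 1 := fun j => by
    have : Nonempty I := ⟨j⟩
    obtain ⟨i, hi⟩ := exists_eq_ciSup_of_finite (f := fun i => X i j * X i j)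
    refine ⟨i, ?_⟩
    rw [hentry, Matrix.one_apply_eq] at hi
    nlinarith [hpos i j]
  have horth : ∀ i j k, j ≠ k → X i j * X i k = 0 := fun i j k hjk => by
    refine le_antisymm ?_ (mul_nonneg (hpos i j) (hpos i k))
    rw [← Matrix.one_apply_ne (α := ℝ) hjk, ← hentry j k]
    exact le_ciSup (f := fun i => X i j * X i k) (Set.finite_range _).bddAbove i
  choose s hs using hone
  have hinj : Function.Injective s := fun j k hjk => by
    by_contra hne
    have h := horth (s j) j k hne
    rw [hs j, hjk, hs k] at h
    norm_num at h
  have hbij := Finite.injective_iff_bijective.mp hinj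
  refine ⟨Equiv.ofBijective s hbij, fun i j => ?_⟩
  obtain ⟨k, rfl⟩ := hbij.2 i
  rw [Equiv.ofBijective_apply]
  split_ifs with h
  · rw [h, hs]
  · have h0 := horth (s k) k j fun hkj => h (congrArg s hkj)
    rwa [hs, one_mul] at h0

/-- `Λ_n^max(A) ≠ ∅` iff `A = λ Iₙ` for some `λ ∈ ℝ₊`. -/
theorem lambdaMax_n_nonempty_iff {n : ℕ} (hn : 0 < n)
    (A : Matrix (Fin n) (Fin n) ℝ) (hA : Nonneg A) :
    (LambdaMax n A).Nonempty ↔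
      ∃ lam : ℝ, 0 ≤ lam ∧ A = lam • (1 : Matrix (Fin n) (Fin n) ℝ) := by
  constructor
  · rintro ⟨lam, hlam, X, hX, hAX⟩
    obtain ⟨σ, hσ⟩ := hX.exists_perm
    refine ⟨lam, hlam, ?_⟩
    have hconj : ∀ j k, maxMul Xᵀ (maxMul A X) j k = A (σ j) (σ k) := fun j k => by
      rw [maxMul_transpose_apply_of_perm _ σ hσ, maxMul_apply_of_perm hA σ hσ]
      intro i k
      rw [maxMul_apply_of_perm hA σ hσ]
      exact hA _ _
    ext i j
    have h := hconj (σ.symm i) (σ.symm j)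
    rw [hAX] at h
    simpa [Matrix.one_apply] using h.symm
  · rintro ⟨lam, hlam, rfl⟩
    have hone : ∀ i j : Fin n, (1 : Matrix (Fin n) (Fin n) ℝ) i j = if i = id j then 1 else 0 :=
      fun i j => Matrix.one_apply
    have hnonneg : Nonneg (1 : Matrix (Fin n) (Fin n) ℝ) := fun i j => by
      rw [hone]
      split_ifs <;> norm_num
    have hright : maxMul (lam • (1 : Matrix (Fin n) (Fin n) ℝ)) 1 = lam • 1 :=
      Matrix.ext fun i j => maxMul_apply_of_perm hA id hone i j
    exact ⟨lam, hlam, 1,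
      ⟨hnonneg, Matrix.ext fun i j => maxMul_transpose_apply_of_perm hnonneg id hone i j⟩,
      hright.symm ▸ Matrix.ext fun i j => maxMul_transpose_apply_of_perm hA id hone i j⟩

end MaxAlg
end

section
/- Let n ≥ 3 and let A ∈ M_n(ℝ₊) be the Toeplitz matrix with entries A_{ij} = a_{i−j} for |i−j| ≤ n−2 and A_{1n} = A_{n1} = 0, where a_i > 0 for every −(n−2) ≤ i ≤ n−2. Then Λ_1^max(A) = [a₀, max_{−(n−2)≤i≤n−2} a_i], Λ_2^max(A) = {a₀}, and Λ_k^max(A) = ∅ for every 3 ≤ k ≤ n. -/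
open Matrix

namespace MaxAlg

variable {I J K : Type*}

/-- An entry of a max product is the attained maximum of its terms. -/
theorem maxMul_apply_eq_iff [Fintype J] [Nonempty J] (A : Matrix I J ℝ) (B : Matrix J K ℝ)
    (i : I) (k : K) (c : ℝ) :
    maxMul A B i k = c ↔ (∀ j, A i j * B j k ≤ c) ∧ ∃ j, A i j * B j k = c := by
  have hbdd : BddAbove (Set.range fun j => A i j * B j k) := (Set.finite_range _).bddAbove
  constructor
  · rintro rfl
    exact ⟨fun j => le_ciSup hbdd j, exists_eq_ciSup_of_finite⟩
  · rintro ⟨hle, j, hj⟩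
    exact le_antisymm (ciSup_le hle) (hj ▸ le_ciSup hbdd j)

/-- An entry of `Xᵗ ⊗ A ⊗ X` is the attained maximum of its terms. -/
theorem maxMul_conj_apply_eq_iff [Fintype I] [Nonempty I] {A : Matrix I I ℝ} {X : Matrix I J ℝ}
    (hX : Nonneg X) (s t : J) (c : ℝ) :
    maxMul Xᵀ (maxMul A X) s t = c ↔
      (∀ i j, X i s * (A i j * X j t) ≤ c) ∧ ∃ i j, X i s * (A i j * X j t) = c := by
  have hAX (i : I) := (maxMul_apply_eq_iff A X i t _).1 rfl
  rw [maxMul_apply_eq_iff]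
  simp only [transpose_apply]
  constructor
  · rintro ⟨hle, i, hi⟩
    obtain ⟨j, hj⟩ := (hAX i).2
    exact ⟨fun i j => (mul_le_mul_of_nonneg_left ((hAX i).1 j) (hX i s)).trans (hle i),
      i, j, by rw [hj, hi]⟩
  · rintro ⟨hle, i, j, hij⟩
    have hle' (i : I) : X i s * maxMul A X i t ≤ c := by
      obtain ⟨j, hj⟩ := (hAX i).2
      exact hj ▸ hle i j
    exact ⟨hle', i, le_antisymm (hle' i)
      (hij ▸ mul_le_mul_of_nonneg_left ((hAX i).1 j) (hX i s))⟩

theorem isMaxIsometry_iff [Fintype I] [Nonempty I] [Fintype J] [DecidableEq J]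
    {X : Matrix I J ℝ} :
    IsMaxIsometry X ↔ Nonneg X ∧ (∀ i s, X i s ≤ 1) ∧ (∀ s, ∃ i, X i s = 1) ∧
      ∀ i s t, s ≠ t → X i s * X i t = 0 := by
  refine and_congr_right fun hX => ?_
  simp only [← Matrix.ext_iff, maxMul_apply_eq_iff, transpose_apply]
  constructor
  · intro h
    refine ⟨fun i s => ?_, fun s => ?_, fun i s t hst => ?_⟩
    · have := (h s s).1 i
      rw [one_apply_eq] at this
      nlinarith [hX i s]
    · obtain ⟨i, hi⟩ := (h s s).2
      rw [one_apply_eq] at hi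
      exact ⟨i, by nlinarith [hX i s]⟩
    · have := (h s t).1 i
      rw [one_apply_ne hst] at this
      exact le_antisymm this (mul_nonneg (hX i s) (hX i t))
  · rintro ⟨hle, hone, hzero⟩ s t
    rcases eq_or_ne s t with rfl | hst
    · rw [one_apply_eq]
      obtain ⟨i, hi⟩ := hone s
      exact ⟨fun i => mul_le_one₀ (hle i s) (hX i s) (hle i s), i, by rw [hi, one_mul]⟩
    · rw [one_apply_ne hst]
      exact ⟨fun i => (hzero i s t hst).le, Classical.arbitrary I, hzero _ s t hst⟩

/-- The entries at which distinct columns of a max isometry witnessing a point of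
`Λ_k^max(A)` are nonzero meet at a zero entry of `A`. -/
theorem apply_eq_zero_of_conj_eq_smul_one [Fintype I] [Nonempty I] [DecidableEq J]
    {A : Matrix I I ℝ} {X : Matrix I J ℝ} (hA : Nonneg A) (hX : Nonneg X) {lam : ℝ}
    (h : maxMul Xᵀ (maxMul A X) = lam • (1 : Matrix J J ℝ)) {s t : J} (hst : s ≠ t) {i j : I}
    (hi : X i s ≠ 0) (hj : X j t ≠ 0) : A i j = 0 := by
  have hle := ((maxMul_conj_apply_eq_iff hX s t _).1 (congrFun₂ h s t)).1 i j
  rw [Matrix.smul_apply, one_apply_ne hst, smul_zero] at hle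
  have h0 := le_antisymm hle
    (mul_nonneg (hX i s) (mul_nonneg (hA i j) (hX j t)))
  simpa [hi, hj] using h0

section Toeplitz

variable {n : ℕ} {a : ℤ → ℝ} {A : Matrix (Fin n) (Fin n) ℝ}

theorem toeplitz_apply_eq_zero_iff (hn : 3 ≤ n)
    (ha : ∀ i : ℤ, -((n : ℤ) - 2) ≤ i → i ≤ (n : ℤ) - 2 → 0 < a i)
    (hA : ∀ i j : Fin n, A i j =
      if ((i.val : ℤ) - (j.val : ℤ)).natAbs ≤ n - 2
      then a ((i.val : ℤ) - (j.val : ℤ)) else 0) (i j : Fin n) :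
    A i j = 0 ↔ (i.val = 0 ∧ j.val = n - 1) ∨ (i.val = n - 1 ∧ j.val = 0) := by
  rw [hA]
  split_ifs with h
  · exact iff_of_false (ha _ (by omega) (by omega)).ne' (by omega)
  · exact iff_of_true rfl (by omega)

theorem toeplitz_nonneg (hn : 3 ≤ n)
    (ha : ∀ i : ℤ, -((n : ℤ) - 2) ≤ i → i ≤ (n : ℤ) - 2 → 0 < a i)
    (hA : ∀ i j : Fin n, A i j =
      if ((i.val : ℤ) - (j.val : ℤ)).natAbs ≤ n - 2
      then a ((i.val : ℤ) - (j.val : ℤ)) else 0) : Nonneg A := by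
  intro i j
  rw [hA]
  split_ifs with h
  · exact (ha _ (by omega) (by omega)).le
  · exact le_rfl

theorem toeplitz_apply_self
    (hA : ∀ i j : Fin n, A i j =
      if ((i.val : ℤ) - (j.val : ℤ)).natAbs ≤ n - 2
      then a ((i.val : ℤ) - (j.val : ℤ)) else 0) (i : Fin n) : A i i = a 0 := by
  simp [hA]

theorem lambdaMax_one_toeplitz (hn : 3 ≤ n)
    (ha : ∀ i : ℤ, -((n : ℤ) - 2) ≤ i → i ≤ (n : ℤ) - 2 → 0 < a i)
    (hA : ∀ i j : Fin n, A i j =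
      if ((i.val : ℤ) - (j.val : ℤ)).natAbs ≤ n - 2
      then a ((i.val : ℤ) - (j.val : ℤ)) else 0) :
    LambdaMax 1 A =
      Set.Icc (a 0) (⨆ i : Set.Icc (-((n : ℤ) - 2)) ((n : ℤ) - 2), a i.1) := by
  have : Nonempty (Fin n) := ⟨⟨0, by omega⟩⟩
  have : Nonempty (Set.Icc (-((n : ℤ) - 2)) ((n : ℤ) - 2)) := ⟨⟨0, by constructor <;> omega⟩⟩
  set M := ⨆ i : Set.Icc (-((n : ℤ) - 2)) ((n : ℤ) - 2), a i.1
  have ha_le (i : ℤ) (h₁ : -((n : ℤ) - 2) ≤ i) (h₂ : i ≤ (n : ℤ) - 2) : a i ≤ M :=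
    le_ciSup (f := fun i : Set.Icc (-((n : ℤ) - 2)) ((n : ℤ) - 2) => a i.1)
      (Set.finite_range _).bddAbove ⟨i, h₁, h₂⟩
  have ha0 : 0 < a 0 := ha 0 (by omega) (by omega)
  have hM0 : 0 < M := ha0.trans_le (ha_le 0 (by omega) (by omega))
  have hA0 := toeplitz_nonneg hn ha hA
  have hAM (i j : Fin n) : A i j ≤ M := by
    rw [hA]
    split_ifs with h
    · exact ha_le _ (by omega) (by omega)
    · exact hM0.le
  ext lam
  constructor
  · rintro ⟨-, X, hX, h⟩
    obtain ⟨hX0, hX1, hone, -⟩ := isMaxIsometry_iff.1 hX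
    obtain ⟨hle, i, j, hij⟩ :=
      (maxMul_conj_apply_eq_iff hX0 0 0 _).1 (congrFun₂ h 0 0)
    simp only [Matrix.smul_apply, one_apply_eq, smul_eq_mul, mul_one] at hle hij
    constructor
    · obtain ⟨p, hp⟩ := hone 0
      simpa [hp, toeplitz_apply_self hA] using hle p p
    · calc lam = X i 0 * (A i j * X j 0) := hij.symm
        _ ≤ 1 * (A i j * 1) :=
          mul_le_mul (hX1 i 0) (mul_le_mul_of_nonneg_left (hX1 j 0) (hA0 i j))
            (mul_nonneg (hA0 i j) (hX0 j 0)) zero_le_one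
        _ ≤ M := by simpa using hAM i j
  · rintro ⟨h₁, h₂⟩
    have hlam : 0 < lam := ha0.trans_le h₁
    obtain ⟨⟨d, hd₁, hd₂⟩, hd⟩ := exists_eq_ciSup_of_finite
      (f := fun i : Set.Icc (-((n : ℤ) - 2)) ((n : ℤ) - 2) => a i.1)
    obtain ⟨p, q, hpq⟩ : ∃ p q : Fin n, (p.val : ℤ) - q.val = d := by
      rcases le_total 0 d with h | h
      · exact ⟨⟨d.toNat, by omega⟩, ⟨0, by omega⟩, by simpa using h⟩
      · exact ⟨⟨0, by omega⟩, ⟨(-d).toNat, by omega⟩, by dsimp only; omega⟩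
    have hApq : A p q = M := by
      rw [hA, if_pos (by omega), hpq]
      exact hd
    have ht1 : lam / M ≤ 1 := div_le_one_of_le₀ h₂ hM0.le
    have ht0 : 0 < lam / M := div_pos hlam hM0
    have htM : M * (lam / M) = lam := mul_div_cancel₀ _ hM0.ne'
    let x : Fin n → ℝ := fun i => if i = p then 1 else if i = q then lam / M else 0
    have hx0 (i : Fin n) : 0 ≤ x i := by
      dsimp only [x]; split_ifs <;> linarith
    have hx1 (i : Fin n) : x i ≤ 1 := by
      dsimp only [x]; split_ifs <;> linarith
    have hxp : x p = 1 := if_pos rfl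
    have hx_le (i : Fin n) (hi : i ≠ p) : x i ≤ lam / M := by
      dsimp only [x]; rw [if_neg hi]; split_ifs <;> linarith
    have hle (i j : Fin n) : x i * (A i j * x j) ≤ lam := by
      by_cases hi : i = p
      · by_cases hj : j = p
        · subst hi hj
          simpa [hxp, toeplitz_apply_self hA] using h₁
        · calc x i * (A i j * x j) ≤ 1 * (M * (lam / M)) :=
                mul_le_mul (hx1 i) (mul_le_mul (hAM i j) (hx_le j hj) (hx0 j) hM0.le)
                  (mul_nonneg (hA0 i j) (hx0 j)) zero_le_one
            _ = lam := by rw [htM, one_mul]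
      · calc x i * (A i j * x j) ≤ lam / M * (M * 1) :=
              mul_le_mul (hx_le i hi) (mul_le_mul (hAM i j) (hx1 j) (hx0 j) hM0.le)
                (mul_nonneg (hA0 i j) (hx0 j)) ht0.le
          _ = lam := by rw [mul_one, mul_comm, htM]
    refine ⟨hlam.le, Matrix.of fun i _ => x i, isMaxIsometry_iff.2
      ⟨fun i _ => hx0 i, fun i _ => hx1 i, fun _ => ⟨p, hxp⟩,
        fun i s t hst => (hst (Subsingleton.elim s t)).elim⟩, ?_⟩
    ext s t
    obtain rfl := Subsingleton.elim s t
    rw [maxMul_conj_apply_eq_iff (X := Matrix.of fun i _ => x i) (fun i _ => hx0 i)]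
    simp only [Matrix.smul_apply, one_apply_eq, smul_eq_mul, mul_one, of_apply]
    refine ⟨hle, ?_⟩
    by_cases hqp : q = p
    · subst hqp
      refine ⟨q, q, le_antisymm (hle q q) ?_⟩
      simpa [hxp, hApq] using h₂
    · refine ⟨p, q, ?_⟩
      rw [hxp, hApq, one_mul, show x q = lam / M by simp [x, hqp], htM]

theorem lambdaMax_two_toeplitz (hn : 3 ≤ n)
    (ha : ∀ i : ℤ, -((n : ℤ) - 2) ≤ i → i ≤ (n : ℤ) - 2 → 0 < a i)
    (hA : ∀ i j : Fin n, A i j =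
      if ((i.val : ℤ) - (j.val : ℤ)).natAbs ≤ n - 2
      then a ((i.val : ℤ) - (j.val : ℤ)) else 0) :
    LambdaMax 2 A = {a 0} := by
  have : Nonempty (Fin n) := ⟨⟨0, by omega⟩⟩
  have ha0 : 0 < a 0 := ha 0 (by omega) (by omega)
  have hA0 := toeplitz_nonneg hn ha hA
  have hzero := toeplitz_apply_eq_zero_iff hn ha hA
  refine Set.eq_singleton_iff_unique_mem.2 ⟨?_, ?_⟩
  · let p : Fin 2 → Fin n := ![⟨0, by omega⟩, ⟨n - 1, by omega⟩]
    have hp (s t : Fin 2) (hst : s ≠ t) : A (p s) (p t) = 0 := by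
      rw [hzero]
      fin_cases s <;> fin_cases t <;> simp [p] at hst ⊢
    have hinj {s t : Fin 2} (hst : p s = p t) : s = t := by
      by_contra hne
      have := hp s t hne
      rw [hst, toeplitz_apply_self hA] at this
      exact ha0.ne' this
    let X : Matrix (Fin n) (Fin 2) ℝ := Matrix.of fun i s => if i = p s then 1 else 0
    have hX0 : Nonneg X := fun i s => by
      simp only [X, of_apply]; split_ifs <;> norm_num
    refine ⟨ha0.le, X, isMaxIsometry_iff.2 ⟨hX0, fun i s => ?_, fun s => ⟨p s, by simp [X]⟩,
      fun i s t hst => ?_⟩, ?_⟩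
    · simp only [X, of_apply]; split_ifs <;> norm_num
    · simp only [X, of_apply]
      split_ifs with h₁ h₂ <;> simp
      exact hst (hinj (h₁.symm.trans h₂))
    · have hval (s t : Fin 2) : A (p s) (p t) = (a 0 • (1 : Matrix (Fin 2) (Fin 2) ℝ)) s t := by
        rcases eq_or_ne s t with rfl | hst
        · simp [toeplitz_apply_self hA]
        · simp [hst, hp s t hst]
      ext s t
      rw [maxMul_conj_apply_eq_iff hX0, ← hval]
      refine ⟨fun i j => ?_, p s, p t, by simp [X]⟩
      have hst := hA0 (p s) (p t)
      simp only [X, of_apply]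
      split_ifs with h₁ h₂
      · rw [h₁, h₂, one_mul, mul_one]
      all_goals simpa using hst
  · rintro lam ⟨-, X, hX, h⟩
    obtain ⟨hX0, -, hone, -⟩ := isMaxIsometry_iff.1 hX
    obtain ⟨q, hq⟩ := hone 1
    have hcorner {i : Fin n} (hi : X i 0 ≠ 0) := (hzero i q).1
      (apply_eq_zero_of_conj_eq_smul_one hA0 hX0 h zero_ne_one hi (by simp [hq]))
    obtain ⟨hle, i, j, hij⟩ := (maxMul_conj_apply_eq_iff hX0 0 0 _).1 (congrFun₂ h 0 0)
    simp only [Matrix.smul_apply, one_apply_eq, smul_eq_mul, mul_one] at hle hij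
    obtain ⟨p, hp⟩ := hone 0
    have hlam : a 0 ≤ lam := by simpa [hp, toeplitz_apply_self hA] using hle p p
    have hne : X i 0 * (A i j * X j 0) ≠ 0 := hij ▸ (ha0.trans_le hlam).ne'
    have hp' := hcorner (i := p) (by simp [hp])
    have hi := hcorner (left_ne_zero_of_mul hne)
    have hj := hcorner (right_ne_zero_of_mul (right_ne_zero_of_mul hne))
    obtain rfl : i = p := by omega
    obtain rfl : j = i := by omega
    simpa [hp, toeplitz_apply_self hA] using hij.symm

theorem lambdaMax_toeplitz_eq_empty (hn : 3 ≤ n)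
    (ha : ∀ i : ℤ, -((n : ℤ) - 2) ≤ i → i ≤ (n : ℤ) - 2 → 0 < a i)
    (hA : ∀ i j : Fin n, A i j =
      if ((i.val : ℤ) - (j.val : ℤ)).natAbs ≤ n - 2
      then a ((i.val : ℤ) - (j.val : ℤ)) else 0) {k : ℕ} (hk : 3 ≤ k) :
    LambdaMax k A = ∅ := by
  have : Nonempty (Fin n) := ⟨⟨0, by omega⟩⟩
  rw [Set.eq_empty_iff_forall_notMem]
  rintro lam ⟨-, X, hX, h⟩
  obtain ⟨hX0, -, hone, -⟩ := isMaxIsometry_iff.1 hX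
  choose p hp using hone
  have hcorner {s t : Fin k} (hst : s ≠ t) := (toeplitz_apply_eq_zero_iff hn ha hA _ _).1
    (apply_eq_zero_of_conj_eq_smul_one (toeplitz_nonneg hn ha hA) hX0 h hst
      (i := p s) (j := p t) (by simp [hp]) (by simp [hp]))
  have h₀₁ := hcorner (s := ⟨0, by omega⟩) (t := ⟨1, by omega⟩) (by simp)
  have h₀₂ := hcorner (s := ⟨0, by omega⟩) (t := ⟨2, by omega⟩) (by simp)
  have h₁₂ := hcorner (s := ⟨1, by omega⟩) (t := ⟨2, by omega⟩) (by simp)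
  omega

end Toeplitz

/-- higher rank numerical ranges of the banded Toeplitz matrix with
`A_{ij} = a_{i-j}` for `|i-j| ≤ n-2`, zero corners, and all `a_i > 0`. -/
theorem lambdaMax_toeplitz {n : ℕ} (hn : 3 ≤ n) (a : ℤ → ℝ)
    (ha : ∀ i : ℤ, -((n : ℤ) - 2) ≤ i → i ≤ (n : ℤ) - 2 → 0 < a i)
    (A : Matrix (Fin n) (Fin n) ℝ)
    (hA : ∀ i j : Fin n, A i j =
      if ((i.val : ℤ) - (j.val : ℤ)).natAbs ≤ n - 2
      then a ((i.val : ℤ) - (j.val : ℤ)) else 0) :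
    LambdaMax 1 A =
        Set.Icc (a 0) (⨆ i : Set.Icc (-((n : ℤ) - 2)) ((n : ℤ) - 2), a i.1) ∧
    LambdaMax 2 A = {a 0} ∧
    ∀ k : ℕ, 3 ≤ k → k ≤ n → LambdaMax k A = ∅ :=
  ⟨lambdaMax_one_toeplitz hn ha hA, lambdaMax_two_toeplitz hn ha hA,
    fun _ hk _ => lambdaMax_toeplitz_eq_empty hn ha hA hk⟩

end MaxAlg
end

section
/- Let A = (a_{ij}) ∈ M_n(ℝ₊) and let k be an integer with n/2 ≤ k < n. Then W_max^k(A) = { max(m, w) : w ∈ W_max^{n−k}(A) }, where m = min{ max_{1≤j≤k} a_{i_j i_j} : 1 ≤ i₁ < i₂ < … < i_k ≤ n }. -/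
open Matrix

namespace MaxAlg

variable {I J K : Type*}

theorem exists_maxTrace_conj_eq [Fintype I] [Finite J] [Nonempty I] [Nonempty J]
    (A : Matrix I I ℝ) (X : Matrix I J ℝ) :
    ∃ j p q, maxTrace (maxMul Xᵀ (maxMul A X)) = X p j * (A p q * X q j) := by
  obtain ⟨j, hj⟩ := exists_eq_ciSup_of_finite (f := fun j => maxMul Xᵀ (maxMul A X) j j)
  obtain ⟨p, hp⟩ := exists_eq_ciSup_of_finite (f := fun p => Xᵀ j p * maxMul A X p j)
  obtain ⟨q, hq⟩ := exists_eq_ciSup_of_finite (f := fun q => A p q * X q j)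
  exact ⟨j, p, q, hj.symm.trans (hp.symm.trans (congrArg (X p j * ·) hq.symm))⟩

theorem le_maxTrace_conj [Fintype I] [Finite J] (A : Matrix I I ℝ) {X : Matrix I J ℝ}
    (hX : Nonneg X) (j : J) (p q : I) :
    X p j * (A p q * X q j) ≤ maxTrace (maxMul Xᵀ (maxMul A X)) := by
  have hq : A p q * X q j ≤ maxMul A X p j :=
    le_ciSup (f := fun q => A p q * X q j) (Set.finite_range _).bddAbove q
  have hp : Xᵀ j p * maxMul A X p j ≤ maxMul Xᵀ (maxMul A X) j j :=
    le_ciSup (f := fun p => Xᵀ j p * maxMul A X p j) (Set.finite_range _).bddAbove p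
  have hj : maxMul Xᵀ (maxMul A X) j j ≤ maxTrace (maxMul Xᵀ (maxMul A X)) :=
    le_ciSup (f := fun j => maxMul Xᵀ (maxMul A X) j j) (Set.finite_range _).bddAbove j
  exact (mul_le_mul_of_nonneg_left hq (hX p j)).trans (hp.trans hj)

theorem continuous_ciSup_of_finite {ι T : Type*} [Finite ι] [Nonempty ι] [TopologicalSpace T]
    {f : ι → T → ℝ} (hf : ∀ i, Continuous (f i)) : Continuous fun t => ⨆ i, f i t := by
  have := Fintype.ofFinite ι
  simp_rw [← Finset.sup'_univ_eq_ciSup]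
  exact Continuous.finset_sup'_apply _ fun i _ => hf i

theorem continuous_maxTrace_conj {T : Type*} [TopologicalSpace T] [Fintype I] [Finite J]
    [Nonempty I] [Nonempty J] (A : Matrix I I ℝ) {X : T → Matrix I J ℝ}
    (hX : ∀ i j, Continuous fun t => X t i j) :
    Continuous fun t => maxTrace (maxMul (X t)ᵀ (maxMul A (X t))) :=
  continuous_ciSup_of_finite fun j => continuous_ciSup_of_finite fun p =>
    (hX p j).mul (continuous_ciSup_of_finite fun q => continuous_const.mul (hX q j))

section Isometry

variable [Fintype I] [Fintype J] [DecidableEq J] {X : Matrix I J ℝ}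

theorem IsMaxIsometry.le_one (hX : IsMaxIsometry X) (i : I) (j : J) : X i j ≤ 1 := by
  have h : X i j * X i j ≤ maxMul Xᵀ X j j :=
    le_ciSup (f := fun i => X i j * X i j) (Set.finite_range _).bddAbove i
  rw [hX.2, Matrix.one_apply_eq] at h
  nlinarith [hX.1 i j]

theorem IsMaxIsometry.exists_eq_one [Nonempty I] (hX : IsMaxIsometry X) (j : J) :
    ∃ i, X i j = 1 := by
  obtain ⟨i, hi⟩ := exists_eq_ciSup_of_finite (f := fun i => X i j * X i j)
  have h : X i j * X i j = maxMul Xᵀ X j j := hi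
  rw [hX.2, Matrix.one_apply_eq] at h
  exact ⟨i, by nlinarith [hX.1 i j]⟩

theorem IsMaxIsometry.mul_eq_zero (hX : IsMaxIsometry X) (i : I) {j l : J} (hjl : j ≠ l) :
    X i j * X i l = 0 := by
  have h : X i j * X i l ≤ maxMul Xᵀ X j l :=
    le_ciSup (f := fun i => X i j * X i l) (Set.finite_range _).bddAbove i
  rw [hX.2, Matrix.one_apply_ne hjl] at h
  exact le_antisymm h (mul_nonneg (hX.1 i j) (hX.1 i l))

theorem IsMaxIsometry.exists_injective [Nonempty I] (hX : IsMaxIsometry X) :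
    ∃ f : J → I, Function.Injective f ∧ ∀ j, X (f j) j = 1 := by
  choose f hf using hX.exists_eq_one
  refine ⟨f, fun j l hjl => ?_, hf⟩
  by_contra hne
  have h := hX.mul_eq_zero (f j) hne
  rw [hf j, hjl, hf l] at h
  norm_num at h

end Isometry

/-- The matrix supported on the graph of `g`, with entries `1` at the representatives `f j` of the
columns and `t` elsewhere on the support. -/
def weightedPartition [DecidableEq I] [DecidableEq J] (f : J → I) (g : I → J) (t : ℝ) :
    Matrix I J ℝ :=
  Matrix.of fun i j => if g i = j then (if f j = i then 1 else t) else 0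

section WeightedPartition

variable [DecidableEq I] [DecidableEq J] {f : J → I} {g : I → J}

theorem isMaxIsometry_weightedPartition [Fintype I] [Fintype J] [Nonempty I]
    (hfg : Function.LeftInverse g f) {t : ℝ} (ht : t ∈ Set.Icc (0 : ℝ) 1) :
    IsMaxIsometry (weightedPartition f g t) := by
  obtain ⟨h0, h1⟩ := ht
  have hnn : Nonneg (weightedPartition f g t) := by
    intro i j
    simp only [weightedPartition, Matrix.of_apply]
    split_ifs <;> norm_num [h0]
  refine ⟨hnn, ?_⟩
  ext j l
  change ⨆ i, weightedPartition f g t i j * weightedPartition f g t i l = _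
  rcases eq_or_ne j l with rfl | hjl
  · rw [Matrix.one_apply_eq]
    refine le_antisymm (ciSup_le fun i => mul_le_one₀ ?_ (hnn i j) ?_)
      (le_ciSup_of_le (Set.finite_range _).bddAbove (f j) ?_)
    · simp only [weightedPartition, Matrix.of_apply]
      split_ifs <;> norm_num [h1]
    · simp only [weightedPartition, Matrix.of_apply]
      split_ifs <;> norm_num [h1]
    · simp [weightedPartition, hfg j]
  · rw [Matrix.one_apply_ne hjl]
    have h : ∀ i, weightedPartition f g t i j * weightedPartition f g t i l = 0 := by
      intro i
      simp only [weightedPartition, Matrix.of_apply]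
      grind
    simp [h]

theorem Icc_subset_WMaxK [Fintype I] [Nonempty I] {k : ℕ} [NeZero k] {A : Matrix I I ℝ}
    (hA : Nonneg A) {f : Fin k → I} {g : I → Fin k} (hfg : Function.LeftInverse g f)
    {p q : I} (hpq : g p = g q) :
    Set.Icc (⨆ j, A (f j) (f j)) (A p q) ⊆ WMaxK k A := by
  rintro v ⟨hv0, hv1⟩
  set F : ℝ → ℝ := fun t =>
    maxTrace (maxMul (weightedPartition f g t)ᵀ (maxMul A (weightedPartition f g t)))
  have hF : Continuous F := continuous_maxTrace_conj A fun i j => by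
    simp only [weightedPartition, Matrix.of_apply]
    split_ifs <;> fun_prop
  have hF0 : F 0 ≤ v := by
    refine le_trans ?_ hv0
    obtain ⟨j, p, q, h⟩ := exists_maxTrace_conj_eq A (weightedPartition f g 0)
    have hle : A (f j) (f j) ≤ ⨆ j, A (f j) (f j) :=
      le_ciSup (f := fun j => A (f j) (f j)) (Set.finite_range _).bddAbove j
    have hnn := hA (f j) (f j)
    change maxTrace _ ≤ _
    rw [h]
    simp only [weightedPartition, Matrix.of_apply]
    split_ifs <;> simp_all <;> linarith
  have hF1 : v ≤ F 1 := by
    refine hv1.trans ?_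
    have h := le_maxTrace_conj A
      (isMaxIsometry_weightedPartition hfg (t := 1) (by simp)).1 (g p) p q
    simpa [F, weightedPartition, hpq] using h
  obtain ⟨t, ht, hFt⟩ := intermediate_value_Icc zero_le_one hF.continuousOn ⟨hF0, hF1⟩
  exact ⟨_, isMaxIsometry_weightedPartition hfg ht, hFt.symm⟩

end WeightedPartition

theorem ciInf_diag_le_of_injective {n k : ℕ} (A : Matrix (Fin n) (Fin n) ℝ)
    {f : Fin k → Fin n} (hf : Function.Injective f) :
    (⨅ g : {g : Fin k → Fin n // StrictMono g}, ⨆ j, A (g.1 j) (g.1 j)) ≤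
      ⨆ j, A (f j) (f j) := by
  rcases isEmpty_or_nonempty (Fin k) with hk | hk
  · simp
  have hcard : (Finset.univ.image f).card = k := by
    simp [Finset.card_image_of_injective _ hf]
  let e := (Finset.univ.image f).orderEmbOfFin hcard
  refine ciInf_le_of_le (Set.finite_range _).bddBelow ⟨e, e.strictMono⟩ (ciSup_le fun j => ?_)
  obtain ⟨i, -, hi⟩ := Finset.mem_image.1 ((Finset.univ.image f).orderEmbOfFin_mem hcard j)
  change A (e j) (e j) ≤ _
  rw [show e j = f i from hi.symm]
  exact le_ciSup (f := fun j => A (f j) (f j)) (Set.finite_range _).bddAbove i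

theorem exists_leftInverse_apply_eq [Nonempty J] {f : J → I} (hf : Function.Injective f)
    {p q : I} (hpq : p = q ∨ p ∉ Set.range f ∨ q ∉ Set.range f) :
    ∃ g : I → J, Function.LeftInverse g f ∧ g p = g q := by
  classical
  have key : ∀ {p q : I}, p ∉ Set.range f →
      ∃ g : I → J, Function.LeftInverse g f ∧ g p = g q := fun {p q} hp =>
    ⟨Function.update (Function.invFun f) p (Function.invFun f q), fun j => by
      rw [Function.update_of_ne fun h => hp ⟨j, h⟩, Function.leftInverse_invFun hf j], by
      rcases eq_or_ne q p with rfl | h <;> simp [*]⟩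
  rcases hpq with rfl | hp | hq
  · exact ⟨_, Function.leftInverse_invFun hf, rfl⟩
  · exact key hp
  · obtain ⟨g, hg, h⟩ := key (q := p) hq
    exact ⟨g, hg, h.symm⟩

theorem Icc_diag_entry_subset_WMaxK [Fintype I] {k : ℕ} [NeZero k] {A : Matrix I I ℝ}
    (hA : Nonneg A) (hk : k < Fintype.card I) {f : Fin k → I} (hf : Function.Injective f)
    (p q : I) : Set.Icc (⨆ j, A (f j) (f j)) (A p q) ⊆ WMaxK k A := by
  classical
  have : Nonempty I := ⟨p⟩
  by_cases hpq : p = q ∨ p ∉ Set.range f ∨ q ∉ Set.range f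
  · obtain ⟨g, hg, h⟩ := exists_leftInverse_apply_eq hf hpq
    exact Icc_subset_WMaxK hA hg h
  push Not at hpq
  obtain ⟨hne, ⟨a, rfl⟩, b, rfl⟩ := hpq
  obtain ⟨r, hr⟩ : ∃ r, r ∉ Set.range f := by
    by_contra! h
    have := Fintype.card_le_of_surjective f h
    simp at this
    omega
  have hf' : Function.Injective (Function.update f b r) := by
    intro i j hij
    simp only [Function.update_apply] at hij
    have hr' : ∀ j, f j ≠ r := fun j h => hr ⟨j, h⟩
    have := @hf i j
    grind
  have hb : f b ∉ Set.range (Function.update f b r) := by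
    rintro ⟨j, hj⟩
    have hr' : ∀ j, f j ≠ r := fun j h => hr ⟨j, h⟩
    have := @hf j b
    simp only [Function.update_apply] at hj
    grind
  intro v ⟨hv0, hv1⟩
  by_cases hv : (⨆ j, A (Function.update f b r j) (Function.update f b r j)) ≤ v
  · obtain ⟨g, hg, h⟩ := exists_leftInverse_apply_eq hf' (p := f a) (Or.inr (Or.inr hb))
    exact Icc_subset_WMaxK hA hg h ⟨hv, hv1⟩
  · obtain ⟨j, hj⟩ := exists_lt_of_lt_ciSup (not_le.1 hv)
    obtain ⟨g, hg, h⟩ := exists_leftInverse_apply_eq hf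
      (p := Function.update f b r j) (Or.inl rfl)
    exact Icc_subset_WMaxK hA hg h ⟨hv0, hj.le⟩

/-- For `0 < k < n`, `W_max^k(A)` is the interval from the smallest possible maximum of `k`
distinct diagonal entries to the largest entry. -/
theorem WMaxK_eq_Icc {n k : ℕ} {A : Matrix (Fin n) (Fin n) ℝ} (hA : Nonneg A)
    (hk : 0 < k) (hkn : k < n) :
    WMaxK k A = Set.Icc (⨅ f : {f : Fin k → Fin n // StrictMono f}, ⨆ j, A (f.1 j) (f.1 j))
      (⨆ p : Fin n × Fin n, A p.1 p.2) := by
  have : NeZero k := ⟨hk.ne'⟩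
  have : NeZero n := ⟨by omega⟩
  apply Set.Subset.antisymm
  · rintro _ ⟨X, hX, rfl⟩
    constructor
    · obtain ⟨f, hf, hf1⟩ := hX.exists_injective
      refine (ciInf_diag_le_of_injective A hf).trans (ciSup_le fun j => ?_)
      simpa [hf1] using le_maxTrace_conj A hX.1 j (f j) (f j)
    · obtain ⟨j, p, q, h⟩ := exists_maxTrace_conj_eq A X
      rw [h]
      refine le_ciSup_of_le (Set.finite_range _).bddAbove (p, q) ?_
      have hq : A p q * X q j ≤ A p q := mul_le_of_le_one_right (hA p q) (hX.le_one q j)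
      exact (mul_le_of_le_one_left (mul_nonneg (hA p q) (hX.1 q j)) (hX.le_one p j)).trans hq
  · have : Nonempty {f : Fin k → Fin n // StrictMono f} :=
      ⟨⟨Fin.castLE hkn.le, Fin.strictMono_castLE hkn.le⟩⟩
    obtain ⟨f, hf⟩ := exists_eq_ciInf_of_finite
      (f := fun f : {f : Fin k → Fin n // StrictMono f} => ⨆ j, A (f.1 j) (f.1 j))
    obtain ⟨p, hp⟩ := exists_eq_ciSup_of_finite (f := fun p : Fin n × Fin n => A p.1 p.2)
    rw [← hf, ← hp]
    exact Icc_diag_entry_subset_WMaxK hA (by simpa using hkn) f.2.injective p.1 p.2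

theorem ciInf_diag_mono {n k l : ℕ} (A : Matrix (Fin n) (Fin n) ℝ) (hl : 0 < l) (hlk : l ≤ k)
    (hkn : k ≤ n) :
    (⨅ f : {f : Fin l → Fin n // StrictMono f}, ⨆ j, A (f.1 j) (f.1 j)) ≤
      ⨅ f : {f : Fin k → Fin n // StrictMono f}, ⨆ j, A (f.1 j) (f.1 j) := by
  have : Nonempty {f : Fin k → Fin n // StrictMono f} :=
    ⟨⟨Fin.castLE hkn, Fin.strictMono_castLE hkn⟩⟩
  have : NeZero l := ⟨hl.ne'⟩
  refine le_ciInf fun f => ciInf_le_of_le (Set.finite_range _).bddBelow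
    ⟨f.1 ∘ Fin.castLE hlk, f.2.comp (Fin.strictMono_castLE hlk)⟩ (ciSup_le fun j => ?_)
  exact le_ciSup (f := fun j => A (f.1 j) (f.1 j)) (Set.finite_range _).bddAbove _

/-- for `n/2 ≤ k < n`,
`W_max^k(A) = { max(m, w) : w ∈ W_max^{n-k}(A) }` where `m` is the minimum over
strictly increasing `k`-tuples of the max of the selected diagonal entries. -/
theorem wmaxK_eq_max_image {n : ℕ} (A : Matrix (Fin n) (Fin n) ℝ) (hA : Nonneg A)
    {k : ℕ} (hk2 : n ≤ 2 * k) (hkn : k < n) :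
    WMaxK k A =
      (fun w => max
          (⨅ f : {f : Fin k → Fin n // StrictMono f}, ⨆ j, A (f.1 j) (f.1 j)) w) ''
        WMaxK (n - k) A := by
  rw [WMaxK_eq_Icc hA (by omega) hkn, WMaxK_eq_Icc hA (k := n - k) (by omega) (by omega)]
  have hmono := ciInf_diag_mono A (l := n - k) (k := k) (by omega) (by omega) hkn.le
  have hne : (Set.Icc (⨅ f : {f : Fin k → Fin n // StrictMono f}, ⨆ j, A (f.1 j) (f.1 j))
      (⨆ p : Fin n × Fin n, A p.1 p.2)).Nonempty := by
    have : NeZero k := ⟨by omega⟩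
    have : Nonempty (Fin n) := ⟨⟨0, by omega⟩⟩
    have hf : Function.LeftInverse (Function.invFun (Fin.castLE hkn.le)) (Fin.castLE hkn.le) :=
      Function.leftInverse_invFun (Fin.castLE_injective hkn.le)
    rw [← WMaxK_eq_Icc hA (by omega) hkn]
    exact ⟨_, _, isMaxIsometry_weightedPartition hf (t := 0) (by simp), rfl⟩
  ext v
  constructor
  · rintro ⟨h0, h1⟩
    exact ⟨v, ⟨hmono.trans h0, h1⟩, max_eq_right h0⟩
  · rintro ⟨w, ⟨-, h1⟩, rfl⟩
    exact ⟨le_max_left _ _, max_le (Set.nonempty_Icc.1 hne) h1⟩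


end MaxAlg
end

section
/- Let 𝔸 = (A₁, …, A_m) with A_i ∈ M_n(ℝ₊) for i = 1, …, m, let 1 ≤ k ≤ n, and define f_𝔸 : 𝒳_{n×k} → ℝ₊^m by f_𝔸(X) = (tr_⊗(Xᵗ⊗A₁⊗X), …, tr_⊗(Xᵗ⊗A_m⊗X)). Then for all X, Y ∈ 𝒳_{n×k}: ‖f_𝔸(X) − f_𝔸(Y)‖ ≤ ‖⊕_{i=1}^{m} A_i‖ · (‖X‖ + ‖Y‖) · ‖X − Y‖, where the differences are taken in ℝ and ‖·‖ denotes the maximum of the absolute values of the entries (for vectors in ℝ^m and for real n×k matrices alike), and ⊕_{i=1}^{m} A_i is the entrywise maximum of A₁, …, A_m. -/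
open Matrix

namespace MaxAlg

variable {I J K : Type*}

theorem abs_apply_le_matNorm [Finite I] [Finite J] (M : Matrix I J ℝ) (i : I) (j : J) :
    |M i j| ≤ matNorm M :=
  (le_ciSup (f := fun j => |M i j|) (Set.finite_range _).bddAbove j).trans
    (le_ciSup (f := fun i => ⨆ j, |M i j|) (Set.finite_range _).bddAbove i)

theorem matNorm_nonneg (M : Matrix I J ℝ) : 0 ≤ matNorm M :=
  Real.iSup_nonneg fun _ => Real.iSup_nonneg fun _ => abs_nonneg _

theorem iSup_le_iSup_add [Finite I] [Nonempty I] {f g : I → ℝ} {c : ℝ}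
    (h : ∀ i, f i ≤ g i + c) : ⨆ i, f i ≤ (⨆ i, g i) + c :=
  ciSup_le fun i => (h i).trans
    (add_le_add_left (le_ciSup (Set.finite_range g).bddAbove i) c)

/-- One-sided bound for the max trace of `Xᵗ ⊗ A ⊗ X` when the entries of `A` are at most `a`. -/
theorem maxTrace_conj_le [Fintype I] [Nonempty I] [Finite J] [Nonempty J]
    {A : Matrix I I ℝ} (hA : Nonneg A) {a : ℝ} (ha : ∀ i j, A i j ≤ a)
    {X Y : Matrix I J ℝ} (hX : Nonneg X) (hY : Nonneg Y) :
    maxTrace (maxMul Xᵀ (maxMul A X)) ≤ maxTrace (maxMul Yᵀ (maxMul A Y)) +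
      a * ((matNorm X + matNorm Y) * matNorm (X - Y)) := by
  refine iSup_le_iSup_add fun i => iSup_le_iSup_add fun p => ?_
  simp only [maxMul, Matrix.of_apply, Matrix.transpose_apply]
  rw [Real.mul_iSup_of_nonneg (hX p i), Real.mul_iSup_of_nonneg (hY p i)]
  refine iSup_le_iSup_add fun q => ?_
  have hXp := (le_abs_self _).trans (abs_apply_le_matNorm X p i)
  have hYq := (le_abs_self _).trans (abs_apply_le_matNorm Y q i)
  have hdp := (le_abs_self _).trans (abs_apply_le_matNorm (X - Y) p i)
  have hdq := (le_abs_self _).trans (abs_apply_le_matNorm (X - Y) q i)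
  have hd := matNorm_nonneg (X - Y)
  rw [Matrix.sub_apply] at hdp hdq
  have key : X p i * (X q i - Y q i) + (X p i - Y p i) * Y q i ≤
      (matNorm X + matNorm Y) * matNorm (X - Y) := by
    have h₁ : X p i * (X q i - Y q i) ≤ matNorm X * matNorm (X - Y) :=
      (mul_le_mul_of_nonneg_left hdq (hX p i)).trans (mul_le_mul_of_nonneg_right hXp hd)
    have h₂ : (X p i - Y p i) * Y q i ≤ matNorm (X - Y) * matNorm Y :=
      (mul_le_mul_of_nonneg_right hdp (hY q i)).trans (mul_le_mul_of_nonneg_left hYq hd)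
    linarith
  have hn : 0 ≤ (matNorm X + matNorm Y) * matNorm (X - Y) :=
    mul_nonneg (add_nonneg (matNorm_nonneg X) (matNorm_nonneg Y)) hd
  have h := (mul_le_mul_of_nonneg_left key (hA p q)).trans
    (mul_le_mul_of_nonneg_right (ha p q) hn)
  linarith

theorem matNorm_sub_comm (X Y : Matrix I J ℝ) : matNorm (X - Y) = matNorm (Y - X) := by
  simp only [matNorm, Matrix.sub_apply, abs_sub_comm]

/-- Lipschitz-type bound
`‖f_𝔸(X) − f_𝔸(Y)‖ ≤ ‖⊕ᵢ Aᵢ‖ (‖X‖ + ‖Y‖) ‖X − Y‖` for max isometries `X, Y`. -/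
theorem joint_trace_lipschitz {n m k : ℕ} (hm : 0 < m) (hk1 : 1 ≤ k) (hkn : k ≤ n)
    (A : Fin m → Matrix (Fin n) (Fin n) ℝ) (hA : ∀ l, Nonneg (A l))
    (X Y : Matrix (Fin n) (Fin k) ℝ) (hX : IsMaxIsometry X) (hY : IsMaxIsometry Y) :
    vecNorm (fun l => maxTrace (maxMul Xᵀ (maxMul (A l) X)) -
                      maxTrace (maxMul Yᵀ (maxMul (A l) Y)))
      ≤ matNorm (Matrix.of fun i j => ⨆ l, A l i j) *
          ((matNorm X + matNorm Y) * matNorm (X - Y)) := by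
  have : NeZero m := ⟨by omega⟩
  have : NeZero k := ⟨by omega⟩
  have : NeZero n := ⟨by omega⟩
  refine ciSup_le fun l => abs_sub_le_iff.2 ?_
  have ha : ∀ i j, A l i j ≤ matNorm (Matrix.of fun i j => ⨆ l, A l i j) := fun i j =>
    (le_ciSup (f := fun l => A l i j) (Set.finite_range _).bddAbove l).trans
      ((le_abs_self _).trans (abs_apply_le_matNorm (Matrix.of fun i j => ⨆ l, A l i j) i j))
  have h₁ := maxTrace_conj_le (hA l) ha hX.1 hY.1
  have h₂ := maxTrace_conj_le (hA l) ha hY.1 hX.1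
  rw [matNorm_sub_comm Y X, add_comm (matNorm Y)] at h₂
  exact ⟨sub_le_iff_le_add'.2 h₁, sub_le_iff_le_add'.2 h₂⟩

end MaxAlg
end
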